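/- Let d = 2 and suppose q = (q̄, q_n(q̄)) is a normalized central configuration with y_{n−1} = 0, x_{n−1} ≠ x_n, and x_{n−1} ≠ 0. Then the rank of DF(q) equals 2n − 1 if and only if the Jacobian matrix D RS at the corresponding point is invertible (equivalently, has rank 2n − 3). -/

import Mathlib

open scoped BigOperators

noncomputable section

/-- Points in `ℝ^d`, with the Euclidean norm. -/
abbrev Pt (d : ℕ) := EuclideanSpace ℝ (Fin d)

/-- `F_i(q) = −q_i + Σ_{j ≠ i} m_j (q_j − q_i)/‖q_j − q_i‖³`. -/
noncomputable def nbodyF {d n : ℕ} (m : Fin n → ℝ) (q : Fin n → Pt d) : Fin n → Pt d :=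
  fun i => -q i + ∑ j ∈ Finset.univ.erase i, (m j / ‖q j - q i‖ ^ 3) • (q j - q i)

/-- A configuration is collision-free if all bodies occupy distinct positions. -/
def CollisionFree {d n : ℕ} (q : Fin n → Pt d) : Prop :=
  ∀ i j, i ≠ j → q i ≠ q j

/-- A normalized central configuration: collision-free, center of mass at the origin,
and `F(q) = 0`. -/
def IsNCC {d n : ℕ} (m : Fin n → ℝ) (q : Fin n → Pt d) : Prop :=
  CollisionFree q ∧ (∑ i, m i • q i) = 0 ∧ nbodyF m q = 0

/-- Embedding of the reduced index set `{1,…,n−1}` into `{1,…,n}`. -/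
def emb {n : ℕ} (i : Fin (n - 1)) : Fin n := Fin.castLE (Nat.sub_le n 1) i

/-- Extend a reduced configuration `q̄ = (q_1,…,q_{n−1})` by the position of the last body,
`q_n(q̄) = −(1/m_n) Σ_{i<n} m_i q_i`, computed from the center of mass condition. -/
noncomputable def extendConfig {d n : ℕ} (m : Fin n → ℝ) (qbar : Fin (n - 1) → Pt d) :
    Fin n → Pt d :=
  fun i => if h : (i : ℕ) < n - 1 then qbar ⟨i, h⟩
    else (-(1 / m i)) • ∑ j : Fin (n - 1), m (emb j) • qbar j

/-- The center-of-mass reduced map `F^red_i(q̄) = F_i(q_1,…,q_{n−1},q_n(q̄))`, `i = 1,…,n−1`. -/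
noncomputable def Fred {d n : ℕ} (m : Fin n → ℝ) (qbar : Fin (n - 1) → Pt d) :
    Fin (n - 1) → Pt d :=
  fun i => nbodyF m (extendConfig m qbar) (emb i)

/-- The Jacobian matrix of `F`, rows and columns indexed by (body, coordinate). -/
noncomputable def jacF {d n : ℕ} (m : Fin n → ℝ) (q : Fin n → Pt d) :
    Matrix (Fin n × Fin d) (Fin n × Fin d) ℝ :=
  fun p p' =>
    fderiv ℝ (fun q' : Fin n → Pt d => nbodyF m q' p.1 p.2) q
      (Pi.single p'.1 (EuclideanSpace.single p'.2 (1 : ℝ)))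

/-- The Jacobian matrix of `F^red`, rows and columns indexed by (body, coordinate). -/
noncomputable def jacFred {d n : ℕ} (m : Fin n → ℝ) (qbar : Fin (n - 1) → Pt d) :
    Matrix (Fin (n - 1) × Fin d) (Fin (n - 1) × Fin d) ℝ :=
  fun p p' =>
    fderiv ℝ (fun q' : Fin (n - 1) → Pt d => Fred m q' p.1 p.2) qbar
      (Pi.single p'.1 (EuclideanSpace.single p'.2 (1 : ℝ)))

/-- The Jacobian matrix of the planar reduced system `RS`: it is obtained from `DF^red`
by removing the row corresponding to `F^red_{n−1,y}` and the column corresponding to the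
variable `y_{n−1}` (here `x = 0`, `y = 1`, and the body of paper-index `n−1` is `⟨n−2,_⟩`). -/
noncomputable def DRS2 {n : ℕ} (hn : 3 ≤ n) (m : Fin n → ℝ) (qbar : Fin (n - 1) → Pt 2) :
    Matrix {p : Fin (n - 1) × Fin 2 // p ≠ (⟨n - 2, by omega⟩, 1)}
      {p : Fin (n - 1) × Fin 2 // p ≠ (⟨n - 2, by omega⟩, 1)} ℝ :=
  (jacFred m qbar).submatrix Subtype.val Subtype.val

theorem sum_sum_eq_zero_of_antisymm {ι : Type*} [Fintype ι] (f : ι → ι → ℝ)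
    (h : ∀ i j, f i j = -f j i) : ∑ i, ∑ j, f i j = 0 := by
  have h1 : ∑ i, ∑ j, f i j = -∑ i, ∑ j, f i j := by
    conv_lhs => rw [Finset.sum_comm]
    simp only [← Finset.sum_neg_distrib]
    exact Finset.sum_congr rfl fun i _ => Finset.sum_congr rfl fun j _ => h j i
  linarith

theorem nbodyF_apply {d n : ℕ} (m : Fin n → ℝ) (q : Fin n → Pt d) (i : Fin n) (k : Fin d) :
    nbodyF m q i k = -q i k + ∑ j, m j / ‖q j - q i‖ ^ 3 * (q j k - q i k) := by
  have h : ∑ j, (m j / ‖q j - q i‖ ^ 3) • (q j - q i)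
      = ∑ j ∈ Finset.univ.erase i, (m j / ‖q j - q i‖ ^ 3) • (q j - q i) :=
    (Finset.sum_erase _ (by simp)).symm
  simp [nbodyF, ← h]

/-- The total force equals minus the weighted sum of positions. -/
theorem sum_mass_mul_nbodyF {d n : ℕ} (m : Fin n → ℝ) (q : Fin n → Pt d) (k : Fin d) :
    ∑ i, m i * nbodyF m q i k = -∑ i, m i * q i k := by
  have h := sum_sum_eq_zero_of_antisymm
    (fun i j => m i * (m j / ‖q j - q i‖ ^ 3 * (q j k - q i k)))
    (fun i j => by rw [norm_sub_rev]; ring)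
  simp only [nbodyF_apply, mul_add, Finset.sum_add_distrib, Finset.mul_sum, h]
  simp

/-- The total torque vanishes identically. -/
theorem sum_torque_nbodyF {n : ℕ} (m : Fin n → ℝ) (q : Fin n → Pt 2) :
    ∑ i, m i * (q i 0 * nbodyF m q i 1 - q i 1 * nbodyF m q i 0) = 0 := by
  rw [← sum_sum_eq_zero_of_antisymm
    (fun i j => m i * (m j / ‖q j - q i‖ ^ 3 * (q i 0 * q j 1 - q i 1 * q j 0)))
    (fun i j => by rw [norm_sub_rev]; ring)]
  refine Finset.sum_congr rfl fun i _ => ?_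
  rw [nbodyF_apply, nbodyF_apply, ← Finset.mul_sum, mul_add, mul_add, Finset.mul_sum,
    Finset.mul_sum, add_sub_add_comm, ← Finset.sum_sub_distrib, mul_neg, mul_neg,
    show -(q i 0 * q i 1) - -(q i 1 * q i 0) = 0 by ring, zero_add]
  congr 1
  exact Finset.sum_congr rfl fun j _ => by ring

theorem differentiableAt_nbodyF {d n : ℕ} (m : Fin n → ℝ) {q : Fin n → Pt d}
    (hq : CollisionFree q) : DifferentiableAt ℝ (nbodyF m) q := by
  have hproj : ∀ i : Fin n, DifferentiableAt ℝ (fun q' : Fin n → Pt d => q' i) q :=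
    fun i => differentiableAt_apply i q
  rw [differentiableAt_pi]
  intro i
  unfold nbodyF
  refine (hproj i).neg.add (DifferentiableAt.fun_sum fun j hj => ?_)
  have hne : q j - q i ≠ 0 := sub_ne_zero.2 (hq j i (Finset.ne_of_mem_erase hj))
  have hsub := (hproj j).sub (hproj i)
  exact (((hsub.norm ℝ hne).pow 3).inv (pow_ne_zero 3 (norm_ne_zero_iff.2 hne))
    |>.const_mul (m j)).smul hsub

/-- The coordinate `(i, k)` of a configuration, as a continuous linear functional. -/
def coordCLM {d n : ℕ} (i : Fin n) (k : Fin d) : (Fin n → Pt d) →L[ℝ] ℝ :=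
  (EuclideanSpace.proj k).comp (ContinuousLinearMap.proj i)

@[simp] theorem coordCLM_apply {d n : ℕ} (i : Fin n) (k : Fin d) (q : Fin n → Pt d) :
    coordCLM i k q = q i k := rfl

theorem hasFDerivAt_nbodyF_apply {d n : ℕ} (m : Fin n → ℝ) {q : Fin n → Pt d}
    (hq : CollisionFree q) (i : Fin n) (k : Fin d) :
    HasFDerivAt (fun q' => nbodyF m q' i k)
      ((coordCLM i k).comp (fderiv ℝ (nbodyF m) q)) q :=
  (coordCLM i k).hasFDerivAt.comp q (differentiableAt_nbodyF m hq).hasFDerivAt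

theorem sum_mass_mul_fderiv_nbodyF {d n : ℕ} (m : Fin n → ℝ) {q : Fin n → Pt d}
    (hq : CollisionFree q) (v : Fin n → Pt d) (k : Fin d) :
    ∑ i, m i * fderiv ℝ (nbodyF m) q v i k = -∑ i, m i * v i k := by
  have h1 := HasFDerivAt.fun_sum (u := Finset.univ)
    fun i _ => (hasFDerivAt_nbodyF_apply m hq i k).const_mul (m i)
  have h2 := (HasFDerivAt.fun_sum (u := Finset.univ)
    fun i _ => (coordCLM (d := d) i k).hasFDerivAt (x := q) |>.const_mul (m i)).neg
  have h3 : (fun q' : Fin n → Pt d => ∑ i, m i * nbodyF m q' i k)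
      = -fun q' => ∑ i, m i * coordCLM i k q' :=
    funext fun q' => sum_mass_mul_nbodyF m q' k
  rw [h3] at h1
  simpa using DFunLike.congr_fun (h1.unique h2) v

theorem sum_torque_fderiv_nbodyF {n : ℕ} (m : Fin n → ℝ) {q : Fin n → Pt 2}
    (hq : CollisionFree q) (hF : nbodyF m q = 0) (v : Fin n → Pt 2) :
    ∑ i, m i * (q i 0 * fderiv ℝ (nbodyF m) q v i 1
      - q i 1 * fderiv ℝ (nbodyF m) q v i 0) = 0 := by
  have hc : ∀ i k, HasFDerivAt (fun q' : Fin n → Pt 2 => q' i k) (coordCLM i k) q :=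
    fun i k => (coordCLM i k).hasFDerivAt
  have h1 := HasFDerivAt.fun_sum (u := Finset.univ) fun i _ =>
    (((hc i 0).fun_mul (hasFDerivAt_nbodyF_apply m hq i 1)).fun_sub
      ((hc i 1).fun_mul (hasFDerivAt_nbodyF_apply m hq i 0))).const_mul (m i)
  simp only [sum_torque_nbodyF] at h1
  simpa [hF] using DFunLike.congr_fun (h1.unique (hasFDerivAt_const (0 : ℝ) q)) v

/-- Quarter turn of every body. -/
def quarterTurn {n : ℕ} (q : Fin n → Pt 2) : Fin n → Pt 2 := fun i => !₂[-q i 1, q i 0]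

theorem norm_rotate (c s : ℝ) (h : c ^ 2 + s ^ 2 = 1) (v w : Pt 2)
    (h0 : w 0 = c * v 0 - s * v 1) (h1 : w 1 = c * v 1 + s * v 0) : ‖w‖ = ‖v‖ := by
  rw [EuclideanSpace.norm_eq, EuclideanSpace.norm_eq]
  congr 1
  simp only [Fin.sum_univ_two, Real.norm_eq_abs, sq_abs, h0, h1]
  linear_combination (v 0 ^ 2 + v 1 ^ 2) * h

theorem nbodyF_rotate {n : ℕ} (m : Fin n → ℝ) (q : Fin n → Pt 2) (c s : ℝ)
    (h : c ^ 2 + s ^ 2 = 1) :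
    nbodyF m (c • q + s • quarterTurn q) = c • nbodyF m q + s • quarterTurn (nbodyF m q) := by
  have hn : ∀ i j, ‖(c • q + s • quarterTurn q) j - (c • q + s • quarterTurn q) i‖
      = ‖q j - q i‖ := fun i j =>
    norm_rotate c s h _ _ (by simp [quarterTurn]; ring) (by simp [quarterTurn]; ring)
  ext i k
  fin_cases k
  · simp only [Fin.zero_eta, nbodyF_apply, hn]
    simp only [quarterTurn, Pi.add_apply, Pi.smul_apply, PiLp.add_apply, PiLp.smul_apply,
      smul_eq_mul, nbodyF_apply, Matrix.cons_val_zero]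
    rw [mul_add c, mul_neg s (_ + _), mul_add s, neg_add (s * _), Finset.mul_sum, Finset.mul_sum,
      add_add_add_comm, ← Finset.sum_neg_distrib, ← Finset.sum_add_distrib]
    congr 1
    · ring
    · exact Finset.sum_congr rfl fun j _ => by ring
  · simp only [Fin.mk_one, nbodyF_apply, hn]
    simp only [quarterTurn, Pi.add_apply, Pi.smul_apply, PiLp.add_apply, PiLp.smul_apply,
      smul_eq_mul, nbodyF_apply, Matrix.cons_val_one, Matrix.cons_val_fin_one]
    rw [mul_add, mul_add, Finset.mul_sum, Finset.mul_sum, add_add_add_comm,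
      ← Finset.sum_add_distrib]
    congr 1
    · ring
    · exact Finset.sum_congr rfl fun j _ => by ring

/-- The infinitesimal rotation lies in the kernel of `DF` at a zero of `F`. -/
theorem fderiv_nbodyF_quarterTurn {n : ℕ} (m : Fin n → ℝ) {q : Fin n → Pt 2}
    (hq : CollisionFree q) (hF : nbodyF m q = 0) :
    fderiv ℝ (nbodyF m) q (quarterTurn q) = 0 := by
  have h1 : HasDerivAt (fun t : ℝ => Real.cos t • q + Real.sin t • quarterTurn q)
      (quarterTurn q) 0 := by
    have h := ((Real.hasDerivAt_cos 0).smul_const q).add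
      ((Real.hasDerivAt_sin 0).smul_const (quarterTurn q))
    rwa [Real.sin_zero, Real.cos_zero, neg_zero, zero_smul, one_smul, zero_add] at h
  have h2 : HasFDerivAt (nbodyF m) (fderiv ℝ (nbodyF m) q)
      (Real.cos 0 • q + Real.sin 0 • quarterTurn q) := by
    simpa using (differentiableAt_nbodyF m hq).hasFDerivAt
  have h3 := h2.comp_hasDerivAt 0 h1
  have h4 : nbodyF m ∘ (fun t : ℝ => Real.cos t • q + Real.sin t • quarterTurn q)
      = fun _ => 0 := by
    funext t
    simp only [Function.comp_apply, nbodyF_rotate m q _ _ (Real.cos_sq_add_sin_sq t), hF]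
    ext i k
    fin_cases k <;> simp [quarterTurn]
  rw [h4] at h3
  exact h3.unique (hasDerivAt_const 0 0)

/-- The configuration with prescribed coordinates. -/
def ofCoords {d n : ℕ} : (Fin n × Fin d → ℝ) →ₗ[ℝ] (Fin n → Pt d) where
  toFun u i := WithLp.toLp 2 fun k => u (i, k)
  map_add' _ _ := rfl
  map_smul' _ _ := rfl

@[simp] theorem ofCoords_apply {d n : ℕ} (u : Fin n × Fin d → ℝ) (i : Fin n) (k : Fin d) :
    ofCoords u i k = u (i, k) := rfl

theorem ofCoords_eq_sum {d n : ℕ} (u : Fin n × Fin d → ℝ) :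
    ofCoords u = ∑ p, u p • (Pi.single p.1 (EuclideanSpace.single p.2 (1 : ℝ)) :
      Fin n → Pt d) := by
  ext i k
  simp only [ofCoords_apply, Finset.sum_apply, Pi.smul_apply, WithLp.ofLp_sum,
    PiLp.smul_apply, smul_eq_mul]
  rw [Finset.sum_eq_single (i, k)]
  · simp
  · rintro ⟨a, b⟩ - hne
    by_cases ha : i = a
    · subst ha
      have : k ≠ b := fun h => hne (by rw [h])
      simp [this]
    · simp [ha]
  · simp

theorem jacF_mulVec {d n : ℕ} (m : Fin n → ℝ) {q : Fin n → Pt d} (hq : CollisionFree q)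
    (u : Fin n × Fin d → ℝ) (p : Fin n × Fin d) :
    (jacF m q).mulVec u p = fderiv ℝ (nbodyF m) q (ofCoords u) p.1 p.2 := by
  rw [ofCoords_eq_sum, ← coordCLM_apply, ← ContinuousLinearMap.comp_apply, map_sum]
  refine Finset.sum_congr rfl fun p' _ => ?_
  rw [map_smul, smul_eq_mul, mul_comm, ← (hasFDerivAt_nbodyF_apply m hq p.1 p.2).fderiv]
  rfl

theorem extendConfig_emb {d n : ℕ} (m : Fin n → ℝ) (w : Fin (n - 1) → Pt d)
    (j : Fin (n - 1)) : extendConfig m w (emb j) = w j := by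
  simp [extendConfig, emb]

/-- `extendConfig` as a continuous linear map. -/
def extendCLM {d n : ℕ} (m : Fin n → ℝ) : (Fin (n - 1) → Pt d) →L[ℝ] (Fin n → Pt d) :=
  LinearMap.toContinuousLinearMap
    { toFun := extendConfig m
      map_add' := fun a b => by
        funext i
        by_cases h : (i : ℕ) < n - 1
        · simp [extendConfig, h]
        · simp only [extendConfig, h, dite_false, Pi.add_apply, smul_add,
            Finset.sum_add_distrib]
      map_smul' := fun c a => by
        funext i
        by_cases h : (i : ℕ) < n - 1 <;>
          simp [extendConfig, h, smul_comm _ c, ← Finset.smul_sum] }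

@[simp] theorem extendCLM_apply {d n : ℕ} (m : Fin n → ℝ) (w : Fin (n - 1) → Pt d) :
    extendCLM m w = extendConfig m w := rfl

theorem jacFred_mulVec {d n : ℕ} (m : Fin n → ℝ) {qbar : Fin (n - 1) → Pt d}
    (hq : CollisionFree (extendConfig m qbar))
    (u : Fin (n - 1) × Fin d → ℝ) (p : Fin (n - 1) × Fin d) :
    (jacFred m qbar).mulVec u p = fderiv ℝ (nbodyF m) (extendConfig m qbar)
      (extendConfig m (ofCoords u)) (emb p.1) p.2 := by
  have h : HasFDerivAt (fun q' => Fred m q' p.1 p.2)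
      (((coordCLM (emb p.1) p.2).comp (fderiv ℝ (nbodyF m) (extendConfig m qbar))).comp
        (extendCLM m)) qbar :=
    (hasFDerivAt_nbodyF_apply m hq (emb p.1) p.2).comp qbar (extendCLM m).hasFDerivAt
  change _ = ((coordCLM (emb p.1) p.2).comp (fderiv ℝ (nbodyF m) (extendConfig m qbar))).comp
    (extendCLM m) (ofCoords u)
  rw [ofCoords_eq_sum, map_sum]
  refine Finset.sum_congr rfl fun p' _ => ?_
  rw [map_smul, smul_eq_mul, mul_comm, ← h.fderiv]
  rfl

theorem sum_eq_sum_emb_add {M : Type*} [AddCommMonoid M] {n : ℕ} (hn : 0 < n) (f : Fin n → M) :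
    ∑ i, f i = ∑ j : Fin (n - 1), f (emb j) + f ⟨n - 1, by omega⟩ := by
  cases n with
  | zero => omega
  | succ k => exact Fin.sum_univ_castSucc f

theorem sum_mass_smul_extendConfig {d n : ℕ} (hn : 0 < n) (m : Fin n → ℝ) (hm : ∀ i, m i ≠ 0)
    (w : Fin (n - 1) → Pt d) : ∑ i, m i • extendConfig m w i = 0 := by
  rw [sum_eq_sum_emb_add hn]
  simp only [extendConfig_emb]
  simp [extendConfig, smul_smul, hm]

theorem forall_fin_of_emb {n : ℕ} (hn : 0 < n) {P : Fin n → Prop} (h : ∀ j, P (emb j))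
    (hl : P ⟨n - 1, by omega⟩) (i : Fin n) : P i := by
  by_cases hi : (i : ℕ) < n - 1
  · exact h ⟨i, hi⟩
  · have : i = ⟨n - 1, by omega⟩ := Fin.ext (by simp only; omega)
    rwa [this]

/-- A configuration with vanishing weighted sum is determined by all bodies but the last. -/
theorem eq_zero_of_emb_eq_zero {d n : ℕ} (hn : 0 < n) (m : Fin n → ℝ) (hm : ∀ i, m i ≠ 0)
    {v : Fin n → Pt d} (hv : ∑ i, m i • v i = 0) (h : ∀ j, v (emb j) = 0) : v = 0 := by
  rw [sum_eq_sum_emb_add hn] at hv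
  funext i
  refine forall_fin_of_emb hn (P := fun i => v i = 0) h ?_ i
  simpa [h, hm] using hv

theorem extendConfig_restrict {d n : ℕ} (hn : 0 < n) (m : Fin n → ℝ) (hm : ∀ i, m i ≠ 0)
    {v : Fin n → Pt d} (hv : ∑ i, m i • v i = 0) :
    extendConfig m (fun j => v (emb j)) = v := by
  refine sub_eq_zero.1 (eq_zero_of_emb_eq_zero hn m hm ?_ fun j => ?_)
  · simp [smul_sub, hv, sum_mass_smul_extendConfig hn m hm]
  · simp [extendConfig_emb]

theorem sum_mass_smul_fderiv_nbodyF {d n : ℕ} (m : Fin n → ℝ) {q : Fin n → Pt d}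
    (hq : CollisionFree q) (v : Fin n → Pt d) :
    ∑ i, m i • fderiv ℝ (nbodyF m) q v i = -∑ i, m i • v i := by
  ext k
  simpa using sum_mass_mul_fderiv_nbodyF m hq v k

theorem rank_jacF_eq_iff {n : ℕ} (hn : 0 < n) (m : Fin n → ℝ) {q : Fin n → Pt 2}
    (hq : CollisionFree q) (hF : nbodyF m q = 0) {i₀ : Fin n} (hi₀ : q i₀ 0 ≠ 0) :
    (jacF m q).rank = 2 * n - 1 ↔
      ∀ v, fderiv ℝ (nbodyF m) q v = 0 → v i₀ 1 = 0 → v = 0 := by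
  have hker : ∀ u : Fin n × Fin 2 → ℝ, u ∈ LinearMap.ker (jacF m q).mulVecLin ↔
      fderiv ℝ (nbodyF m) q (ofCoords u) = 0 := fun u => by
    rw [LinearMap.mem_ker, Matrix.mulVecLin_apply]
    constructor
    · intro h
      ext i k
      simpa [jacF_mulVec m hq] using congrFun h (i, k)
    · intro h
      funext p
      rw [jacF_mulVec m hq, h]
      rfl
  set r : LinearMap.ker (jacF m q).mulVecLin :=
    ⟨fun p => quarterTurn q p.1 p.2, (hker _).2 (fderiv_nbodyF_quarterTurn m hq hF)⟩ with hr
  have hr0 : r ≠ 0 := fun h => hi₀ (congrFun (congrArg Subtype.val h) (i₀, 1))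
  have hdim := LinearMap.finrank_range_add_finrank_ker (jacF m q).mulVecLin
  rw [← Matrix.rank, Module.finrank_fintype_fun_eq_card, Fintype.card_prod, Fintype.card_fin,
    Fintype.card_fin] at hdim
  have h1 : (jacF m q).rank = 2 * n - 1 ↔
      Module.finrank ℝ (LinearMap.ker (jacF m q).mulVecLin) = 1 := by omega
  rw [h1, finrank_eq_one_iff_of_nonzero' r hr0]
  constructor
  · intro h v hv hv0
    obtain ⟨c, hc⟩ := h ⟨fun p => v p.1 p.2, (hker _).2 hv⟩
    have hc' : ∀ p : Fin n × Fin 2, c * quarterTurn q p.1 p.2 = v p.1 p.2 :=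
      fun p => congrFun (congrArg Subtype.val hc) p
    have hc0 : c = 0 := by
      have h2 := hc' (i₀, 1)
      simp only [hv0, quarterTurn] at h2
      simpa [hi₀] using h2
    ext i k
    simp [← hc' (i, k), hc0]
  · rintro h ⟨u, hu⟩
    have h2 := h (ofCoords u - (u (i₀, 1) / q i₀ 0) • quarterTurn q)
      (by rw [map_sub, map_smul, (hker u).1 hu, fderiv_nbodyF_quarterTurn m hq hF]; simp)
      (by simp [quarterTurn, hi₀])
    refine ⟨u (i₀, 1) / q i₀ 0, Subtype.ext (funext fun p => ?_)⟩
    have h3 := congrArg (coordCLM p.1 p.2) (sub_eq_zero.1 h2)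
    exact h3.symm

/-- If `DF(q)` maps an extended configuration to one vanishing outside the `y`-coordinate of the
second to last body (among the first `n - 1` bodies), then it maps it to zero. -/
theorem fderiv_nbodyF_eq_zero_of_reduced {n : ℕ} (hn : 3 ≤ n) (m : Fin n → ℝ)
    (hm : ∀ i, m i ≠ 0) {q : Fin n → Pt 2} (hq : CollisionFree q) (hF : nbodyF m q = 0)
    (hx : q ⟨n - 2, by omega⟩ 0 ≠ q ⟨n - 1, Nat.sub_one_lt_of_lt hn⟩ 0) {v : Fin n → Pt 2}
    (hv : ∑ i, m i • v i = 0)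
    (h : ∀ p : Fin (n - 1) × Fin 2, p ≠ (⟨n - 2, by omega⟩, 1) →
      fderiv ℝ (nbodyF m) q v (emb p.1) p.2 = 0) :
    fderiv ℝ (nbodyF m) q v = 0 := by
  have hsum := sum_mass_smul_fderiv_nbodyF m hq v
  have htorque := sum_torque_fderiv_nbodyF m hq hF v
  set a := fderiv ℝ (nbodyF m) q v
  rw [hv, neg_zero] at hsum
  refine eq_zero_of_emb_eq_zero (by omega) m hm hsum fun j => ?_
  set l : Fin (n - 1) := ⟨n - 2, by omega⟩ with hl
  have h0 : ∀ j, a (emb j) 0 = 0 := fun j => h (j, 0) (by simp)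
  have h1 : ∀ j, j ≠ l → a (emb j) 1 = 0 := fun j hj => h (j, 1) (by simp [hj])
  have hs : ∀ k, ∑ i, m i * a i k = 0 := fun k => by
    simpa using congrArg (fun z : Pt 2 => z k) hsum
  have hs0 := hs 0
  have hs1 := hs 1
  rw [sum_eq_sum_emb_add (by omega)] at hs0 hs1 htorque
  rw [Finset.sum_eq_single l (fun j _ hj => by simp [h1 j hj]) (by simp)] at hs1
  rw [Finset.sum_eq_single l (fun j _ hj => by simp [h0 j, h1 j hj]) (by simp)] at htorque
  have hlast : a ⟨n - 1, by omega⟩ 0 = 0 := by simpa [h0, hm] using hs0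
  have hxl : q (emb l) 0 - q ⟨n - 1, by omega⟩ 0 ≠ 0 := sub_ne_zero.2 hx
  have hprod : m (emb l) * (q (emb l) 0 - q ⟨n - 1, by omega⟩ 0) * a (emb l) 1 = 0 := by
    rw [h0, hlast] at htorque
    linear_combination htorque - q ⟨n - 1, by omega⟩ 0 * hs1
  have hal : a (emb l) 1 = 0 :=
    (mul_eq_zero.1 hprod).resolve_left (mul_ne_zero (hm _) hxl)
  ext k
  fin_cases k
  · exact h0 j
  · by_cases hj : j = l
    · rw [hj]; exact hal
    · exact h1 j hj

theorem isUnit_DRS2_iff {n : ℕ} (hn : 3 ≤ n) (m : Fin n → ℝ) (hm : ∀ i, m i ≠ 0)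
    (qbar : Fin (n - 1) → Pt 2) (hq : CollisionFree (extendConfig m qbar))
    (hF : nbodyF m (extendConfig m qbar) = 0)
    (hx : extendConfig m qbar ⟨n - 2, by omega⟩ 0
      ≠ extendConfig m qbar ⟨n - 1, Nat.sub_one_lt_of_lt hn⟩ 0) :
    IsUnit (DRS2 hn m qbar) ↔
      ∀ v, fderiv ℝ (nbodyF m) (extendConfig m qbar) v = 0 →
        v ⟨n - 2, by omega⟩ 1 = 0 → v = 0 := by
  set p₀ : Fin (n - 1) × Fin 2 := (⟨n - 2, by omega⟩, 1) with hp₀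
  have hmul : ∀ (w : Fin (n - 1) × Fin 2 → ℝ), w p₀ = 0 →
      ∀ p : {p : Fin (n - 1) × Fin 2 // p ≠ p₀},
      (DRS2 hn m qbar).mulVec (fun p' => w p'.1) p
        = fderiv ℝ (nbodyF m) (extendConfig m qbar) (extendConfig m (ofCoords w))
          (emb p.1.1) p.1.2 := by
    intro w hw p
    rw [← jacFred_mulVec m hq, Matrix.mulVec, Matrix.mulVec, dotProduct, dotProduct,
      ← Finset.sum_erase Finset.univ (a := p₀) (by simp [hw])]
    symm
    exact Finset.sum_subtype _ (fun x => by simp [-Prod.mk.injEq, hp₀]) _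
  rw [← Matrix.mulVec_injective_iff_isUnit, ← Matrix.coe_mulVecLin,
    injective_iff_map_eq_zero]
  constructor
  · intro h v hv hv0
    have hvs : ∑ i, m i • v i = 0 := by
      have h1 := sum_mass_smul_fderiv_nbodyF m hq v
      simpa [hv] using h1
    refine eq_zero_of_emb_eq_zero (by omega) m hm hvs fun j => ?_
    have hw : extendConfig m (ofCoords fun p : Fin (n - 1) × Fin 2 => v (emb p.1) p.2) = v :=
      extendConfig_restrict (by omega) m hm hvs
    have h2 := h (fun p => v (emb p.1.1) p.1.2) <| funext fun p => by
      rw [Matrix.mulVecLin_apply, hmul (fun p => v (emb p.1) p.2) hv0, hw, hv]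
      rfl
    ext k
    by_cases hp : (j, k) = p₀
    · rw [hp₀, Prod.mk.injEq] at hp
      rw [hp.1, hp.2]
      exact hv0
    · exact congrFun h2 ⟨(j, k), hp⟩
  · intro h u hu
    classical
    set w : Fin (n - 1) × Fin 2 → ℝ := fun p => if hp : p ≠ p₀ then u ⟨p, hp⟩ else 0 with hw
    have hw0 : w p₀ = 0 := by simp [hw]
    have hwu : (fun p' : {p : Fin (n - 1) × Fin 2 // p ≠ p₀} => w p'.1) = u := by
      funext p
      simp [hw, p.2]
    have h1 : fderiv ℝ (nbodyF m) (extendConfig m qbar) (extendConfig m (ofCoords w)) = 0 := by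
      refine fderiv_nbodyF_eq_zero_of_reduced hn m hm hq hF hx
        (sum_mass_smul_extendConfig (by omega) m hm _) fun p hp => ?_
      rw [← hmul w hw0 ⟨p, hp⟩, hwu]
      exact congrFun hu ⟨p, hp⟩
    have h2 := h _ h1 <| by
      have h3 := extendConfig_emb m (ofCoords w) ⟨n - 2, by omega⟩
      exact (congrArg (fun z : Pt 2 => z 1) h3).trans hw0
    rw [← hwu]
    funext p
    have h3 := extendConfig_emb m (ofCoords w) p.1.1
    rw [h2] at h3
    exact (congrArg (fun z : Pt 2 => z p.1.2) h3).symm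

/-- for a planar nCC with `y_{n−1} = 0`, `x_{n−1} ≠ x_n`, `x_{n−1} ≠ 0`,
`rank(DF(q)) = 2n − 1` iff `D RS` is invertible. -/
theorem stmt8 {n : ℕ} (hn : 3 ≤ n) (m : Fin n → ℝ) (hm : ∀ i, 0 < m i)
    (qbar : Fin (n - 1) → Pt 2) (hcc : IsNCC m (extendConfig m qbar))
    (hy : qbar ⟨n - 2, by omega⟩ 1 = 0)
    (hx1 : qbar ⟨n - 2, by omega⟩ 0 ≠ extendConfig m qbar ⟨n - 1, by omega⟩ 0)
    (hx2 : qbar ⟨n - 2, by omega⟩ 0 ≠ 0) :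
    (jacF m (extendConfig m qbar)).rank = 2 * n - 1 ↔ IsUnit (DRS2 hn m qbar) := by
  have hpos : ∀ i, m i ≠ 0 := fun i => (hm i).ne'
  have he : extendConfig m qbar ⟨n - 2, by omega⟩ = qbar ⟨n - 2, by omega⟩ :=
    extendConfig_emb m qbar ⟨n - 2, by omega⟩
  obtain ⟨hq, -, hF⟩ := hcc
  rw [isUnit_DRS2_iff hn m hpos qbar hq hF (by rw [he]; exact hx1)]
  exact rank_jacF_eq_iff (by omega) m hq hF (by rw [he]; exact hx2)
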